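/- Fix real numbers P, S > 0 with P < S³/27, and set k = 4P/S³ (so 0 < k < 4/27). Then there exist a unique α ∈ (0, 2/3) and a unique β ∈ (2/3, 1) with α² − α³ = k and β² − β³ = k, and for all positive reals x, y, z with x + y + z = S and xyz = P one has (1/4)S²(4α − 3α²) ≤ xy + yz + zx ≤ (1/4)S²(4β − 3β²). -/

import Mathlib

/-- Evaluating at `x` both the monic cubic with roots `x, y, z` and the monic cubic having
the same sum and product of roots, a double root `a` and a simple root `c`, expresses the
difference of the second elementary symmetric polynomials. -/
theorem sq_sub_mul_sub_eq_esymm_sub_mul {R : Type*} [CommRing R] {x y z a c : R}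
    (hsum : x + y + z = 2 * a + c) (hprod : x * y * z = a ^ 2 * c) :
    (x - a) ^ 2 * (x - c) = (a ^ 2 + 2 * a * c - (x * y + y * z + z * x)) * x := by
  linear_combination x ^ 2 * hsum + hprod

theorem le_esymm_of_double_root_le {x y z a c : ℝ} (hx : 0 < x) (hy : 0 < y) (hz : 0 < z)
    (hsum : x + y + z = 2 * a + c) (hprod : x * y * z = a ^ 2 * c) (hac : a ≤ c) :
    a ^ 2 + 2 * a * c ≤ x * y + y * z + z * x := by
  by_contra! h
  have key : ∀ {u v w : ℝ}, 0 < u → u + v + w = 2 * a + c → u * v * w = a ^ 2 * c →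
      u * v + v * w + w * u < a ^ 2 + 2 * a * c → c < u := by
    intro u v w hu hs hp he
    have hpos : 0 < (u - a) ^ 2 * (u - c) := by
      rw [sq_sub_mul_sub_eq_esymm_sub_mul hs hp]
      exact mul_pos (sub_pos.2 he) hu
    exact sub_pos.1 (pos_of_mul_pos_right hpos (sq_nonneg _))
  have h₁ := key hx hsum hprod h
  have h₂ := key (v := z) (w := x) hy (by linarith) (by linarith) (by linarith)
  have h₃ := key (v := x) (w := y) hz (by linarith) (by linarith) (by linarith)
  linarith

theorem esymm_le_of_le_double_root {x y z a c : ℝ} (hx : 0 < x) (hy : 0 < y) (hz : 0 < z)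
    (hsum : x + y + z = 2 * a + c) (hprod : x * y * z = a ^ 2 * c) (hca : c ≤ a) :
    x * y + y * z + z * x ≤ a ^ 2 + 2 * a * c := by
  by_contra! h
  have key : ∀ {u v w : ℝ}, 0 < u → u + v + w = 2 * a + c → u * v * w = a ^ 2 * c →
      a ^ 2 + 2 * a * c < u * v + v * w + w * u → u < c := by
    intro u v w hu hs hp he
    have hpos : 0 < (u - a) ^ 2 * (c - u) := by
      have := mul_pos (sub_pos.2 he) hu
      linarith [sq_sub_mul_sub_eq_esymm_sub_mul hs hp]
    exact sub_pos.1 (pos_of_mul_pos_right hpos (sq_nonneg _))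
  have h₁ := key hx hsum hprod h
  have h₂ := key (v := z) (w := x) hy (by linarith) (by linarith) (by linarith)
  have h₃ := key (v := x) (w := y) hz (by linarith) (by linarith) (by linarith)
  linarith

theorem injOn_sq_sub_cube_Ioo_zero :
    Set.InjOn (fun t : ℝ => t ^ 2 - t ^ 3) (Set.Ioo 0 (2 / 3)) := by
  rintro a ⟨ha₀, ha⟩ b ⟨hb₀, hb⟩ hab
  have hfactor : (a - b) * (a + b - (a ^ 2 + a * b + b ^ 2)) = 0 := by
    linear_combination hab
  have hpos : 0 < a + b - (a ^ 2 + a * b + b ^ 2) := by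
    nlinarith [mul_pos ha₀ (sub_pos.2 ha), mul_pos hb₀ (sub_pos.2 hb),
      mul_pos ha₀ (sub_pos.2 hb), mul_pos hb₀ (sub_pos.2 ha)]
  exact sub_eq_zero.1 ((mul_eq_zero.1 hfactor).resolve_right hpos.ne')

theorem injOn_sq_sub_cube_Ioi :
    Set.InjOn (fun t : ℝ => t ^ 2 - t ^ 3) (Set.Ioi (2 / 3)) := by
  intro a ha b hb hab
  rw [Set.mem_Ioi] at ha hb
  have hfactor : (a - b) * (a ^ 2 + a * b + b ^ 2 - (a + b)) = 0 := by
    linear_combination -hab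
  have hpos : 0 < a ^ 2 + a * b + b ^ 2 - (a + b) := by
    nlinarith [mul_pos (sub_pos.2 ha) (sub_pos.2 hb), sq_nonneg (a - 2 / 3),
      sq_nonneg (b - 2 / 3)]
  exact sub_eq_zero.1 ((mul_eq_zero.1 hfactor).resolve_right hpos.ne')

theorem stmt_10 (P S : ℝ) (hP : 0 < P) (hS : 0 < S) (hPS : P < S^3 / 27) :
    ∃ α β : ℝ,
      (α ∈ Set.Ioo (0:ℝ) (2/3) ∧ α^2 - α^3 = 4*P/S^3 ∧
        ∀ α' ∈ Set.Ioo (0:ℝ) (2/3), α'^2 - α'^3 = 4*P/S^3 → α' = α) ∧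
      (β ∈ Set.Ioo (2/3 : ℝ) 1 ∧ β^2 - β^3 = 4*P/S^3 ∧
        ∀ β' ∈ Set.Ioo (2/3 : ℝ) 1, β'^2 - β'^3 = 4*P/S^3 → β' = β) ∧
      ∀ x y z : ℝ, 0 < x → 0 < y → 0 < z → x + y + z = S → x*y*z = P →
        (1/4) * S^2 * (4*α - 3*α^2) ≤ x*y + y*z + z*x ∧
        x*y + y*z + z*x ≤ (1/4) * S^2 * (4*β - 3*β^2) := by
  have hS3 : 0 < S ^ 3 := by positivity
  have hk₀ : 0 < 4 * P / S ^ 3 := by positivity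
  have hk : 4 * P / S ^ 3 < 4 / 27 := by
    rw [div_lt_iff₀ hS3]
    linarith
  have hcont : Continuous (fun t : ℝ => t ^ 2 - t ^ 3) := by fun_prop
  obtain ⟨α, hα, hαk⟩ := intermediate_value_Ioo (a := (0 : ℝ)) (b := 2 / 3) (by norm_num)
    hcont.continuousOn (show 4 * P / S ^ 3 ∈ _ from ⟨by simpa using hk₀, by norm_num; exact hk⟩)
  obtain ⟨β, hβ, hβk⟩ := intermediate_value_Ioo' (a := (2 / 3 : ℝ)) (b := 1) (by norm_num)
    hcont.continuousOn (show 4 * P / S ^ 3 ∈ _ from ⟨by simpa using hk₀, by norm_num; exact hk⟩)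
  have hprod : ∀ t : ℝ, t ^ 2 - t ^ 3 = 4 * P / S ^ 3 →
      P = (S * t / 2) ^ 2 * (S * (1 - t)) := by
    intro t ht
    rw [eq_div_iff hS3.ne'] at ht
    linear_combination -ht / 4
  refine ⟨α, β,
    ⟨hα, hαk, fun t ht h => injOn_sq_sub_cube_Ioo_zero ht hα (h.trans hαk.symm)⟩,
    ⟨hβ, hβk, fun t ht h => injOn_sq_sub_cube_Ioi ht.1 hβ.1 (h.trans hβk.symm)⟩,
    fun x y z hx hy hz hsum hP' => ⟨?_, ?_⟩⟩
  · have := le_esymm_of_double_root_le (a := S * α / 2) (c := S * (1 - α)) hx hy hz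
      (by linarith) (hP'.trans (hprod α hαk)) (by nlinarith [hα.2])
    linarith
  · have := esymm_le_of_le_double_root (a := S * β / 2) (c := S * (1 - β)) hx hy hz
      (by linarith) (hP'.trans (hprod β hβk)) (by nlinarith [hβ.1])
    linarith
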